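/- Let ℓ ≥ 1 and let ψ₁, …, ψ_ℓ : ℝ → ℝ be C∞ functions with ψᵢ(0) = 0 such that for each i there exist a neighborhood of 0 and a C∞ function aᵢ with ψᵢ'(x) = aᵢ(x)·x² on it. Then there exist open neighborhoods W, W' of 0 in ℝ × ℝ^ℓ, a C∞ diffeomorphism H̃ : W → W' with H̃(0) = 0, C∞ functions μ₁, …, μ_ℓ : ℝ → ℝ, and a neighborhood V of 0 in ℝ such that for all x ∈ V, H̃(x³/3, ψ₁(x), …, ψ_ℓ(x)) = (x³/3, μ₁(x)·x⁴, …, μ_ℓ(x)·x⁴). -/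

import Mathlib

open scoped ContDiff

theorem hasDerivAt_integral_pow_mul_comp_mul {b : ℝ → ℝ} (hb : ContDiff ℝ 1 b) (k : ℕ) (x₀ : ℝ) :
    HasDerivAt (fun x => ∫ t in (0 : ℝ)..1, t ^ k * b (t * x))
      (∫ t in (0 : ℝ)..1, t ^ (k + 1) * deriv b (t * x₀)) x₀ := by
  have hb' : Continuous (deriv b) := hb.continuous_deriv le_rfl
  obtain ⟨C, hC⟩ := (isCompact_closedBall (0 : ℝ) (|x₀| + 1)).exists_bound_of_continuousOn
    hb'.continuousOn
  have hbc := hb.continuous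
  refine (intervalIntegral.hasDerivAt_integral_of_dominated_loc_of_deriv_le
    (F := fun x t => t ^ k * b (t * x)) (F' := fun x t => t ^ (k + 1) * deriv b (t * x))
    (bound := fun _ => C) (Metric.ball_mem_nhds x₀ one_pos) ?_ ?_ ?_ ?_ ?_ ?_).2
  · exact Filter.Eventually.of_forall fun x =>
      (by fun_prop : Continuous fun t : ℝ => t ^ k * b (t * x)).aestronglyMeasurable
  · exact (by fun_prop : Continuous fun t : ℝ => t ^ k * b (t * x₀)).intervalIntegrable _ _
  · exact (by fun_prop :
      Continuous fun t : ℝ => t ^ (k + 1) * deriv b (t * x₀)).aestronglyMeasurable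
  · refine Filter.Eventually.of_forall fun t ht x hx => ?_
    rw [Set.uIoc_of_le zero_le_one] at ht
    have hx' : |x| ≤ |x₀| + 1 := by
      have h₁ : |x - x₀| < 1 := by simpa [Real.dist_eq] using hx
      have h₂ := abs_sub_abs_le_abs_sub x x₀
      linarith
    have hmem : t * x ∈ Metric.closedBall (0 : ℝ) (|x₀| + 1) := by
      rw [mem_closedBall_zero_iff, Real.norm_eq_abs, abs_mul, abs_of_pos ht.1]
      exact (mul_le_of_le_one_left (abs_nonneg x) ht.2).trans hx'
    rw [norm_mul, norm_pow, Real.norm_of_nonneg ht.1.le]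
    exact (mul_le_of_le_one_left (norm_nonneg _) (pow_le_one₀ ht.1.le ht.2)).trans (hC _ hmem)
  · exact intervalIntegrable_const
  · refine Filter.Eventually.of_forall fun t _ x _ => ?_
    have h₁ : HasDerivAt (fun x : ℝ => t * x) t x := by
      simpa using (hasDerivAt_id x).const_mul t
    have h₂ := ((hb.differentiable one_ne_zero (t * x)).hasDerivAt.comp x h₁).const_mul (t ^ k)
    exact h₂.congr_deriv (by ring)

theorem contDiff_nat_integral_pow_mul_comp_mul (n : ℕ) {b : ℝ → ℝ} (hb : ContDiff ℝ n b)
    (k : ℕ) : ContDiff ℝ n (fun x => ∫ t in (0 : ℝ)..1, t ^ k * b (t * x)) := by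
  induction n generalizing b k with
  | zero =>
    have hbc := hb.continuous
    exact contDiff_zero.2 (intervalIntegral.continuous_parametric_intervalIntegral_of_continuous'
      (by fun_prop) 0 1)
  | succ n ih =>
    have hd := hasDerivAt_integral_pow_mul_comp_mul
      (hb.of_le (by exact_mod_cast Nat.le_add_left 1 n)) k
    push_cast at hb ⊢
    refine contDiff_succ_iff_deriv.2 ⟨fun x => (hd x).differentiableAt, by simp, ?_⟩
    rw [funext fun x => (hd x).deriv]
    exact ih (contDiff_succ_iff_deriv.1 hb).2.2 (k + 1)

theorem contDiff_integral_pow_mul_comp_mul {b : ℝ → ℝ} (hb : ContDiff ℝ ∞ b) (k : ℕ) :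
    ContDiff ℝ ∞ (fun x => ∫ t in (0 : ℝ)..1, t ^ k * b (t * x)) :=
  contDiff_infty.2 fun n => contDiff_nat_integral_pow_mul_comp_mul n (contDiff_infty.1 hb n) k

theorem mul_integral_deriv_comp_mul {f : ℝ → ℝ} (hf : ContDiff ℝ 1 f) (x : ℝ) :
    x * ∫ t in (0 : ℝ)..1, deriv f (t * x) = f x - f 0 := by
  have hf' : Continuous (deriv f) := hf.continuous_deriv le_rfl
  rw [← intervalIntegral.integral_const_mul,
    intervalIntegral.integral_eq_sub_of_hasDerivAt (f := fun t => f (t * x))]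
  · simp
  · intro t _
    have h₁ : HasDerivAt (fun t : ℝ => t * x) x t := by
      simpa using (hasDerivAt_id t).mul_const x
    rw [mul_comm x]
    exact (hf.differentiable one_ne_zero (t * x)).hasDerivAt.comp t h₁
  · exact (by fun_prop : Continuous fun t : ℝ => x * deriv f (t * x)).intervalIntegrable _ _

/-- Hadamard's lemma in one variable. -/
theorem exists_contDiff_eq_add_mul {a : ℝ → ℝ} (ha : ContDiff ℝ ∞ a) :
    ∃ b : ℝ → ℝ, ContDiff ℝ ∞ b ∧ ∀ x, a x = a 0 + x * b x := by
  refine ⟨fun x => ∫ t in (0 : ℝ)..1, deriv a (t * x), ?_, fun x => ?_⟩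
  · simpa using contDiff_integral_pow_mul_comp_mul (contDiff_infty_iff_deriv.1 ha).2 0
  · simp [mul_integral_deriv_comp_mul (ha.of_le (by exact_mod_cast le_top)) x]

theorem exists_contDiff_eventually_eq_mul_pow_succ {f b : ℝ → ℝ} (k : ℕ) (hf : ContDiff ℝ 1 f)
    (hf0 : f 0 = 0) (hb : ContDiff ℝ ∞ b) (h : ∀ᶠ x in nhds 0, deriv f x = b x * x ^ k) :
    ∃ μ : ℝ → ℝ, ContDiff ℝ ∞ μ ∧ ∀ᶠ x in nhds 0, f x = μ x * x ^ (k + 1) := by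
  refine ⟨_, contDiff_integral_pow_mul_comp_mul hb k, ?_⟩
  obtain ⟨ε, hε, hball⟩ := Metric.eventually_nhds_iff_ball.1 h
  filter_upwards [Metric.ball_mem_nhds 0 hε] with x hx
  have key := mul_integral_deriv_comp_mul hf x
  have hcongr : ∫ t in (0 : ℝ)..1, deriv f (t * x) =
      ∫ t in (0 : ℝ)..1, x ^ k * (t ^ k * b (t * x)) := by
    refine intervalIntegral.integral_congr fun t ht => ?_
    rw [Set.uIcc_of_le zero_le_one] at ht
    have hmem : t * x ∈ Metric.ball (0 : ℝ) ε := by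
      rw [mem_ball_zero_iff] at hx ⊢
      rw [norm_mul, Real.norm_of_nonneg ht.1]
      exact (mul_le_of_le_one_left (norm_nonneg x) ht.2).trans_lt hx
    simp only [hball _ hmem]
    ring
  rw [hcongr, intervalIntegral.integral_const_mul, hf0, sub_zero] at key
  rw [← key]
  ring

theorem exists_eventually_eq_const_mul_add_mul_pow_four {ψ a : ℝ → ℝ} (hψ : ContDiff ℝ ∞ ψ)
    (hψ0 : ψ 0 = 0) (ha : ContDiff ℝ ∞ a) (h : ∀ᶠ x in nhds 0, deriv ψ x = a x * x ^ 2) :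
    ∃ (c : ℝ) (μ : ℝ → ℝ), ContDiff ℝ ∞ μ ∧
      ∀ᶠ x in nhds 0, ψ x = c * (x ^ 3 / 3) + μ x * x ^ 4 := by
  obtain ⟨b, hb, hab⟩ := exists_contDiff_eq_add_mul ha
  have hψ1 : ContDiff ℝ 1 ψ := hψ.of_le (by exact_mod_cast le_top)
  obtain ⟨μ, hμ, hev⟩ := exists_contDiff_eventually_eq_mul_pow_succ
    (f := fun x => ψ x - a 0 * (x ^ 3 / 3)) 3 (by fun_prop) (by simp [hψ0]) hb <| by
      filter_upwards [h] with x hx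
      have hcube : HasDerivAt (fun x : ℝ => a 0 * (x ^ 3 / 3)) (a 0 * (3 * x ^ 2 / 3)) x := by
        simpa using ((hasDerivAt_pow 3 x).div_const 3).const_mul (a 0)
      rw [((hψ1.differentiable one_ne_zero x).hasDerivAt.fun_sub hcube).deriv, hx, hab x]
      ring
  refine ⟨a 0, μ, hμ, ?_⟩
  filter_upwards [hev] with x hx
  linarith

/-- For `g(x) = x³/3`, any opening `(g, ψ₁, …, ψ_ℓ)` of `g`
(`ψᵢ(0) = 0`, `ψᵢ' = aᵢ·x²` near `0`) can be transformed, by a C∞ diffeomorphism `H̃`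
between neighborhoods of `0` in `ℝ × ℝ^ℓ` fixing `0`, into `(x³/3, μ₁x⁴, …, μ_ℓx⁴)`
near `0`. -/
theorem opening_eq_jacobianSq_opening_dim_one (l : ℕ) (hl : 1 ≤ l)
    (ψ : Fin l → ℝ → ℝ)
    (hψ : ∀ i, ContDiff ℝ ∞ (ψ i)) (hψ0 : ∀ i, ψ i 0 = 0)
    (hram : ∀ i, ∃ (U : Set ℝ) (a : ℝ → ℝ),
      U ∈ nhds (0 : ℝ) ∧ ContDiff ℝ ∞ a ∧
      ∀ x ∈ U, deriv (ψ i) x = a x * x ^ 2) :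
    ∃ (W W' : Set (ℝ × (Fin l → ℝ)))
      (H G : ℝ × (Fin l → ℝ) → ℝ × (Fin l → ℝ))
      (μ : Fin l → ℝ → ℝ) (V : Set ℝ),
      IsOpen W ∧ IsOpen W' ∧ (0 : ℝ × (Fin l → ℝ)) ∈ W ∧
      (0 : ℝ × (Fin l → ℝ)) ∈ W' ∧
      ContDiffOn ℝ ∞ H W ∧ ContDiffOn ℝ ∞ G W' ∧
      (∀ q ∈ W, H q ∈ W') ∧ (∀ q ∈ W', G q ∈ W) ∧
      (∀ q ∈ W, G (H q) = q) ∧ (∀ q ∈ W', H (G q) = q) ∧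
      H 0 = 0 ∧
      (∀ i, ContDiff ℝ ∞ (μ i)) ∧
      V ∈ nhds (0 : ℝ) ∧
      ∀ x ∈ V,
        H (x ^ 3 / 3, fun i => ψ i x) = (x ^ 3 / 3, fun i => μ i x * x ^ 4) := by
  have hex : ∀ i, ∃ (c : ℝ) (μ : ℝ → ℝ), ContDiff ℝ ∞ μ ∧
      ∀ᶠ x in nhds 0, ψ i x = c * (x ^ 3 / 3) + μ x * x ^ 4 := fun i => by
    obtain ⟨U, a, hU, ha, h⟩ := hram i
    exact exists_eventually_eq_const_mul_add_mul_pow_four (hψ i) (hψ0 i) ha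
      (Filter.mem_of_superset hU h)
  choose c μ hμ hev using hex
  refine ⟨Set.univ, Set.univ, fun q => (q.1, fun i => q.2 i - c i * q.1),
    fun q => (q.1, fun i => q.2 i + c i * q.1), μ, _, isOpen_univ, isOpen_univ, trivial, trivial,
    ContDiff.contDiffOn (by fun_prop), ContDiff.contDiffOn (by fun_prop), fun _ _ => trivial,
    fun _ _ => trivial, fun q _ => by simp, fun q _ => by simp, ?_, hμ,
    Filter.eventually_all.2 hev, fun x hx => ?_⟩
  · ext <;> simp
  · ext i
    · rfl
    · simp [hx i]
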